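/- Suppose the matrix A together with γ̄ satisfies Assumption 2, let X(t) be generated by the algorithm from X₀ ∈ S(n,d,γ̄), and let v(X₀) ∈ S^{n-1} be the strictly positive unit vector to which all Euclidean-normalized rows of Ã(k,t₀,X₀) converge. If the row vector v(X₀)X₀ ∈ ℝ^d is nonzero, then asymptotic consensus of directions holds with point-wise convergence: for every i, x_i(t)/‖x_i(t)‖₂ converges to v(X₀)X₀/‖v(X₀)X₀‖₂ as t → ∞, and the convergence is linear (geometric). -/

import Mathlib

open Finset Filter Topology Matrix

noncomputable def euclNorm {d : ℕ} (x : Fin d → ℝ) : ℝ := Real.sqrt (∑ j, x j ^ 2)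

def unitSphere (d : ℕ) : Set (Fin d → ℝ) := {x | euclNorm x = 1}

/-- A directional function on `S^{d-1}`: continuous and bounded above and below
by positive constants on the unit sphere. -/
def IsDirectional {d : ℕ} (γ : (Fin d → ℝ) → ℝ) : Prop :=
  ContinuousOn γ (unitSphere d) ∧
    ∃ c C : ℝ, 0 < c ∧ ∀ x ∈ unitSphere d, c ≤ γ x ∧ γ x ≤ C

/-- The star boundary `S^{d-1}_γ = {γ(x) x : x ∈ S^{d-1}}`. -/
def starBoundary {d : ℕ} (γ : (Fin d → ℝ) → ℝ) : Set (Fin d → ℝ) :=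
  {y | ∃ x ∈ unitSphere d, y = γ x • x}

/-- `S(n,d,γ̄)`: matrices whose `i`-th row lies on the star boundary of `γ_i`. -/
def Sset (n d : ℕ) (γbar : Fin n → (Fin d → ℝ) → ℝ) : Set (Matrix (Fin n) (Fin d) ℝ) :=
  {X | ∀ i, X i ∈ starBoundary (γbar i)}

/-- Radial projection `P_γ(y) = γ(y/‖y‖₂) · y/‖y‖₂`. -/
noncomputable def radialProj {d : ℕ} (γ : (Fin d → ℝ) → ℝ) (y : Fin d → ℝ) : Fin d → ℝ :=
  γ ((euclNorm y)⁻¹ • y) • ((euclNorm y)⁻¹ • y)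

/-- Row-wise radial projection. -/
noncomputable def rowProj {n d : ℕ} (γbar : Fin n → (Fin d → ℝ) → ℝ)
    (B : Matrix (Fin n) (Fin d) ℝ) : Matrix (Fin n) (Fin d) ℝ :=
  Matrix.of fun i => radialProj (γbar i) (B i)

/-- Assumption 2: each `γ_i` is directional, `A` is a nonnegative weight matrix of a strongly
connected digraph, and the diagonal-dominance condition
`a_ii · min γ_i > Σ_{j≠i} a_ij · max γ_j` holds. -/
def Assumption2 {n d : ℕ} (A : Matrix (Fin n) (Fin n) ℝ)
    (γbar : Fin n → (Fin d → ℝ) → ℝ) : Prop :=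
  (∀ i, IsDirectional (γbar i)) ∧
  (∃ E : Fin n → Fin n → Prop,
    (∀ i j, E i j → 0 < A i j) ∧ (∀ i j, ¬ E i j → A i j = 0) ∧
    (∀ i j, Relation.ReflTransGen E i j)) ∧
  (∀ i, (∑ j ∈ Finset.univ.erase i, A i j * sSup (γbar j '' unitSphere d)) <
      A i i * sInf (γbar i '' unitSphere d))

/-- The trajectory of the algorithm `X(t+1) = P_γ̄(A X(t))`, indexed by `k = t - t₀`. -/
noncomputable def traj {n d : ℕ} (A : Matrix (Fin n) (Fin n) ℝ)
    (γbar : Fin n → (Fin d → ℝ) → ℝ) (X₀ : Matrix (Fin n) (Fin d) ℝ) :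
    ℕ → Matrix (Fin n) (Fin d) ℝ
  | 0 => X₀
  | k + 1 => rowProj γbar (A * traj A γbar X₀ k)

/-- `D_γ̄(B)`: diagonal matrix with entries `γ_i([B]_i/‖[B]_i‖₂)/‖[B]_i‖₂`. -/
noncomputable def Dmat {n d : ℕ} (γbar : Fin n → (Fin d → ℝ) → ℝ)
    (B : Matrix (Fin n) (Fin d) ℝ) : Matrix (Fin n) (Fin n) ℝ :=
  Matrix.diagonal fun i => γbar i ((euclNorm (B i))⁻¹ • B i) / euclNorm (B i)

/-- The product matrices `Ã(k,t₀,X₀) = D_γ̄(A X(t₀+k−1))A ⋯ D_γ̄(A X(t₀))A`. -/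
noncomputable def Atilde {n d : ℕ} (A : Matrix (Fin n) (Fin n) ℝ)
    (γbar : Fin n → (Fin d → ℝ) → ℝ) (X₀ : Matrix (Fin n) (Fin d) ℝ) :
    ℕ → Matrix (Fin n) (Fin n) ℝ
  | 0 => 1
  | k + 1 => Dmat γbar (A * traj A γbar X₀ k) * A * Atilde A γbar X₀ k

/-- `v` is the strictly positive unit vector to which all Euclidean-normalized rows of
`Ã(k,t₀,X₀)` converge. -/
def IsLimitVec {n d : ℕ} (A : Matrix (Fin n) (Fin n) ℝ)
    (γbar : Fin n → (Fin d → ℝ) → ℝ) (X₀ : Matrix (Fin n) (Fin d) ℝ)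
    (v : Fin n → ℝ) : Prop :=
  euclNorm v = 1 ∧ (∀ i, 0 < v i) ∧
    ∀ i, Tendsto (fun k => (euclNorm (Atilde A γbar X₀ k i))⁻¹ • Atilde A γbar X₀ k i)
      atTop (𝓝 v)

/-- Asymptotic consensus of directions. -/
def ConsensusDir {n d : ℕ} (X : ℕ → Matrix (Fin n) (Fin d) ℝ) : Prop :=
  ∀ i j, Tendsto
    (fun t => euclNorm ((euclNorm (X t i))⁻¹ • X t i - (euclNorm (X t j))⁻¹ • X t j))
    atTop (𝓝 0)

/-- Asymptotic consensus of directions with point-wise convergence to a unit vector. -/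
def ConsensusPW {n d : ℕ} (X : ℕ → Matrix (Fin n) (Fin d) ℝ) : Prop :=
  ∃ u : Fin d → ℝ, euclNorm u = 1 ∧
    ∀ i, Tendsto (fun t => (euclNorm (X t i))⁻¹ • X t i) atTop (𝓝 u)

section PositiveProducts

variable {ι : Type*}

/-- A sequence of matrices `M t` entrywise comparable to `A`. -/
structure Comparable (A : Matrix ι ι ℝ) (M : ℕ → Matrix ι ι ℝ) (δ Δ : ℝ) : Prop where
  nonneg : ∀ i j, 0 ≤ A i j
  pos : 0 < δ
  upper_pos : 0 < Δ
  lower : ∀ t i j, δ * A i j ≤ M t i j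
  upper : ∀ t i j, M t i j ≤ Δ * A i j

theorem Comparable.entry_nonneg {A : Matrix ι ι ℝ} {M : ℕ → Matrix ι ι ℝ} {δ Δ : ℝ}
    (h : Comparable A M δ Δ) (t : ℕ) (i j : ι) : 0 ≤ M t i j :=
  (mul_nonneg h.pos.le (h.nonneg i j)).trans (h.lower t i j)

variable [Fintype ι]

theorem exists_pos_forall_le {f : ι → ℝ} (hf : ∀ i, 0 < f i) :
    ∃ δ : ℝ, 0 < δ ∧ ∀ i, δ ≤ f i := by
  rcases isEmpty_or_nonempty ι with h | h
  · exact ⟨1, one_pos, fun i => h.elim i⟩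
  · obtain ⟨i, hi⟩ := Finite.exists_min f
    exact ⟨f i, hf i, hi⟩

theorem exists_pos_forall_ge (f : ι → ℝ) : ∃ Δ : ℝ, 0 < Δ ∧ ∀ i, f i ≤ Δ := by
  obtain ⟨M, hM⟩ := (Set.finite_range f).bddAbove
  exact ⟨max M 1, lt_max_of_lt_right one_pos,
    fun i => (hM (Set.mem_range_self i)).trans (le_max_left _ _)⟩

theorem mulVec_nonneg {A : Matrix ι ι ℝ} (hA : ∀ i j, 0 ≤ A i j) {x : ι → ℝ}
    (h : ∀ i, 0 ≤ x i) (i : ι) : 0 ≤ (A *ᵥ x) i :=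
  Finset.sum_nonneg fun j _ => mul_nonneg (hA i j) (h j)

theorem Comparable.orbit_nonneg {A : Matrix ι ι ℝ} {M : ℕ → Matrix ι ι ℝ} {δ Δ : ℝ}
    (h : Comparable A M δ Δ) {x : ℕ → ι → ℝ} (hx : ∀ t, x (t + 1) = M t *ᵥ x t)
    {s : ℕ} (hs : ∀ i, 0 ≤ x s i) {t : ℕ} (hst : s ≤ t) (i : ι) : 0 ≤ x t i := by
  induction t, hst using Nat.le_induction generalizing i with
  | base => exact hs i
  | succ t _ ih =>
    rw [hx]
    exact mulVec_nonneg (h.entry_nonneg t) ih i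

variable [DecidableEq ι]

theorem pow_entry_nonneg {A : Matrix ι ι ℝ} (hA : ∀ i j, 0 ≤ A i j) (k : ℕ) (i j : ι) :
    0 ≤ (A ^ k) i j := by
  induction k generalizing i j with
  | zero =>
    rw [pow_zero, Matrix.one_apply]
    split_ifs <;> norm_num
  | succ k ih =>
    rw [pow_succ, Matrix.mul_apply]
    exact Finset.sum_nonneg fun l _ => mul_nonneg (ih i l) (hA l j)

theorem pow_succ_entry_pos {A : Matrix ι ι ℝ} (hA : ∀ i j, 0 ≤ A i j) {k : ℕ} {i j l : ι}
    (h₁ : 0 < (A ^ k) i j) (h₂ : 0 < A j l) : 0 < (A ^ (k + 1)) i l := by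
  rw [pow_succ, Matrix.mul_apply]
  exact Finset.sum_pos' (fun m _ => mul_nonneg (pow_entry_nonneg hA k i m) (hA m l))
    ⟨j, Finset.mem_univ j, mul_pos h₁ h₂⟩

/-- A nonnegative matrix with positive diagonal and strongly connected graph is primitive. -/
theorem exists_pow_entry_pos {A : Matrix ι ι ℝ} (hA : ∀ i j, 0 ≤ A i j)
    (hdiag : ∀ i, 0 < A i i) {E : ι → ι → Prop} (hE : ∀ i j, E i j → 0 < A i j)
    (hconn : ∀ i j, Relation.ReflTransGen E i j) :
    ∃ N : ℕ, 0 < N ∧ ∀ i j, 0 < (A ^ N) i j := by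
  have hex : ∀ p : ι × ι, ∃ k : ℕ, 0 < (A ^ k) p.1 p.2 := by
    rintro ⟨i, j⟩
    induction hconn i j with
    | refl => exact ⟨0, by simp⟩
    | tail _ hbc ih =>
      obtain ⟨k, hk⟩ := ih
      exact ⟨k + 1, pow_succ_entry_pos hA hk (hE _ _ hbc)⟩
  choose k hk using hex
  refine ⟨∑ p, k p + 1, Nat.succ_pos _, fun i j => ?_⟩
  have hle : k (i, j) ≤ ∑ p, k p + 1 :=
    (Finset.single_le_sum (f := k) (fun _ _ => Nat.zero_le _)
      (Finset.mem_univ (i, j))).trans (Nat.le_succ _)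
  generalize ∑ p, k p + 1 = m at hle
  induction m, hle using Nat.le_induction with
  | base => exact hk (i, j)
  | succ m _ ih => exact pow_succ_entry_pos hA ih (hdiag j)

theorem Comparable.orbit_bounds {A : Matrix ι ι ℝ} {M : ℕ → Matrix ι ι ℝ} {δ Δ : ℝ}
    (h : Comparable A M δ Δ) {x : ℕ → ι → ℝ} (hx : ∀ t, x (t + 1) = M t *ᵥ x t)
    {s : ℕ} (hs : ∀ i, 0 ≤ x s i) (k : ℕ) (i : ι) :
    δ ^ k * ((A ^ k) *ᵥ x s) i ≤ x (s + k) i ∧ x (s + k) i ≤ Δ ^ k * ((A ^ k) *ᵥ x s) i := by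
  induction k generalizing i with
  | zero => simp
  | succ k ih =>
    have hnn := fun j => h.orbit_nonneg hx hs (Nat.le_add_right s k) j
    have hstep : x (s + (k + 1)) i = ∑ j, M (s + k) i j * x (s + k) j := by
      rw [← add_assoc, hx]; rfl
    have hpow : ((A ^ (k + 1)) *ᵥ x s) i = ∑ j, A i j * ((A ^ k) *ᵥ x s) j := by
      rw [pow_succ', ← Matrix.mulVec_mulVec]; rfl
    rw [hstep, hpow, Finset.mul_sum, Finset.mul_sum]
    constructor
    · refine Finset.sum_le_sum fun j _ => ?_
      calc δ ^ (k + 1) * (A i j * ((A ^ k) *ᵥ x s) j)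
          = (δ * A i j) * (δ ^ k * ((A ^ k) *ᵥ x s) j) := by ring
        _ ≤ (δ * A i j) * x (s + k) j :=
          mul_le_mul_of_nonneg_left (ih j).1 (mul_nonneg h.pos.le (h.nonneg i j))
        _ ≤ _ := mul_le_mul_of_nonneg_right (h.lower _ i j) (hnn j)
    · refine Finset.sum_le_sum fun j _ => ?_
      calc M (s + k) i j * x (s + k) j
          ≤ (Δ * A i j) * x (s + k) j := mul_le_mul_of_nonneg_right (h.upper _ i j) (hnn j)
        _ ≤ (Δ * A i j) * (Δ ^ k * ((A ^ k) *ᵥ x s) j) :=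
          mul_le_mul_of_nonneg_left (ih j).2 (mul_nonneg h.upper_pos.le (h.nonneg i j))
        _ = _ := by ring

/-- Over blocks of a fixed length, nonnegative orbits are equivalent to their total mass. -/
theorem Comparable.exists_block_bounds {A : Matrix ι ι ℝ} {M : ℕ → Matrix ι ι ℝ} {δ Δ : ℝ}
    (h : Comparable A M δ Δ) {N : ℕ} (hN : ∀ i j, 0 < (A ^ N) i j) :
    ∃ ε K : ℝ, 0 < ε ∧ ε ≤ K ∧ ∀ x : ℕ → ι → ℝ, (∀ t, x (t + 1) = M t *ᵥ x t) →
      ∀ s, (∀ i, 0 ≤ x s i) → ∀ i, ε * ∑ j, x s j ≤ x (s + N) i ∧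
        x (s + N) i ≤ K * ∑ j, x s j := by
  obtain ⟨ε, hε, hεle⟩ := exists_pos_forall_le (f := fun p : ι × ι => (A ^ N) p.1 p.2)
    fun p => hN _ _
  obtain ⟨K, _, hleK⟩ := exists_pos_forall_ge (fun p : ι × ι => (A ^ N) p.1 p.2)
  refine ⟨δ ^ N * ε, max (Δ ^ N * K) (δ ^ N * ε), mul_pos (pow_pos h.pos N) hε,
    le_max_right _ _, fun x hx s hs i => ?_⟩
  obtain ⟨hlo, hup⟩ := h.orbit_bounds hx hs N i
  constructor
  · refine le_trans ?_ hlo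
    rw [mul_assoc, Finset.mul_sum]
    exact mul_le_mul_of_nonneg_left
      (Finset.sum_le_sum fun j _ => mul_le_mul_of_nonneg_right (hεle (i, j)) (hs j))
      (pow_pos h.pos N).le
  · refine hup.trans (le_trans ?_ (mul_le_mul_of_nonneg_right (le_max_left _ _)
      (Finset.sum_nonneg fun j _ => hs j)))
    rw [mul_assoc, Finset.mul_sum]
    exact mul_le_mul_of_nonneg_left
      (Finset.sum_le_sum fun j _ => mul_le_mul_of_nonneg_right (hleK (i, j)) (hs j))
      (pow_pos h.upper_pos N).le

/-- The ratios of two orbits lie in nested intervals whose lengths decay geometrically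
in the number of blocks. -/
theorem Comparable.exists_nested_ratio_bounds {A : Matrix ι ι ℝ} {M : ℕ → Matrix ι ι ℝ}
    {δ Δ : ℝ} (h : Comparable A M δ Δ) {N : ℕ} (hN : ∀ i j, 0 < (A ^ N) i j) :
    ∃ ρ : ℝ, 0 < ρ ∧ ρ < 1 ∧ ∀ f g : ℕ → ι → ℝ, (∀ t, f (t + 1) = M t *ᵥ f t) →
      (∀ t, g (t + 1) = M t *ᵥ g t) → (∀ i, g 0 i = 1) →
      ∃ B : ℝ, 0 ≤ B ∧ ∀ k : ℕ, ∃ a b : ℝ, b - a ≤ B * ρ ^ k ∧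
        ∀ t, k * N ≤ t → ∀ i, a * g t i ≤ f t i ∧ f t i ≤ b * g t i := by
  obtain ⟨ε, K, hε, hεK, hblock⟩ := h.exists_block_bounds hN
  have hK : 0 < K := hε.trans_le hεK
  set η : ℝ := ε / (2 * K) with hη_def
  have hη : 0 < η := by positivity
  have hηK : η * K = ε / 2 := by rw [hη_def]; field_simp
  have hη1 : η < 1 := by
    rw [hη_def, div_lt_one (by positivity)]; linarith
  refine ⟨1 - η, by linarith, by linarith, fun f g hf hg hg0 => ?_⟩
  let comb : ℝ → ℝ → ℕ → ι → ℝ := fun p q t i => p * f t i + q * g t i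
  have hlin : ∀ p q t, comb p q (t + 1) = M t *ᵥ comb p q t := by
    intro p q t
    have : comb p q t = p • f t + q • g t := rfl
    rw [this, Matrix.mulVec_add, Matrix.mulVec_smul, Matrix.mulVec_smul, ← hf, ← hg]
    rfl
  have hpersist : ∀ a b : ℝ, ∀ s, (∀ i, a * g s i ≤ f s i ∧ f s i ≤ b * g s i) →
      ∀ t, s ≤ t → ∀ i, a * g t i ≤ f t i ∧ f t i ≤ b * g t i := by
    intro a b s hs t hst i
    have h₁ := h.orbit_nonneg (x := comb 1 (-a)) (hlin _ _) (s := s)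
      (fun i => by simp only [comb]; linarith [(hs i).1]) hst i
    have h₂ := h.orbit_nonneg (x := comb (-1) b) (hlin _ _) (s := s)
      (fun i => by simp only [comb]; linarith [(hs i).2]) hst i
    simp only [comb] at h₁ h₂
    constructor <;> linarith
  have hgnn : ∀ t i, 0 ≤ g t i := fun t i =>
    h.orbit_nonneg hg (s := 0) (fun i => by rw [hg0]; exact zero_le_one) (Nat.zero_le t) i
  obtain ⟨b₀, hb₀, hfb₀⟩ := exists_pos_forall_ge fun i => |f 0 i|
  refine ⟨2 * b₀, by positivity, fun k => ?_⟩
  induction k with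
  | zero =>
    refine ⟨-b₀, b₀, by simp; linarith, fun t _ => hpersist _ _ 0 (fun i => ?_) t (Nat.zero_le t)⟩
    rw [hg0, mul_one, mul_one]
    exact abs_le.mp (hfb₀ i)
  | succ k ih =>
    obtain ⟨a, b, hab, hk⟩ := ih
    have hs := hk (k * N) le_rfl
    set s := k * N
    have hsN : (k + 1) * N = s + N := by rw [Nat.succ_mul]
    have hG : ∀ i, g (s + N) i ≤ K * ∑ j, g s j := fun i => (hblock g hg s (hgnn s) i).2
    have hlo : ∀ i, ε * (∑ j, f s j - a * ∑ j, g s j) ≤ f (s + N) i - a * g (s + N) i := by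
      intro i
      have := (hblock (comb 1 (-a)) (hlin _ _) s
        (fun j => by simp only [comb]; linarith [(hs j).1]) i).1
      simp only [comb] at this
      rw [Finset.sum_add_distrib, ← Finset.mul_sum, ← Finset.mul_sum] at this
      linarith
    have hhi : ∀ i, ε * (b * ∑ j, g s j - ∑ j, f s j) ≤ b * g (s + N) i - f (s + N) i := by
      intro i
      have := (hblock (comb (-1) b) (hlin _ _) s
        (fun j => by simp only [comb]; linarith [(hs j).2]) i).1
      simp only [comb] at this
      rw [Finset.sum_add_distrib, ← Finset.mul_sum, ← Finset.mul_sum] at this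
      linarith
    have hnew : (b - a) - η * (b - a) ≤ 2 * b₀ * (1 - η) ^ (k + 1) := by
      rw [pow_succ]
      nlinarith
    have hkN := hk (s + N) (Nat.le_add_right _ _)
    by_cases hba : b - a < 0
    · refine ⟨a, b, ?_, fun t ht => hk t (le_trans (Nat.le_add_right _ _) (hsN ▸ ht))⟩
      have : 0 ≤ 2 * b₀ * (1 - η) ^ (k + 1) :=
        mul_nonneg (by positivity) (pow_nonneg (by linarith) _)
      linarith
    push Not at hba
    have hηG : ∀ i, η * (b - a) * g (s + N) i ≤ ε / 2 * ((b - a) * ∑ j, g s j) := by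
      intro i
      calc η * (b - a) * g (s + N) i ≤ η * (b - a) * (K * ∑ j, g s j) :=
            mul_le_mul_of_nonneg_left (hG i) (mul_nonneg hη.le hba)
        _ = (η * K) * ((b - a) * ∑ j, g s j) := by ring
        _ = _ := by rw [hηK]
    rw [hsN]
    rcases le_total ((b - a) * ∑ j, g s j) (2 * (∑ j, f s j - a * ∑ j, g s j)) with hc | hc
    · refine ⟨a + η * (b - a), b, by linarith, hpersist _ _ _ fun i => ⟨?_, (hkN i).2⟩⟩
      have := mul_le_mul_of_nonneg_left hc hε.le
      linarith [hlo i, hηG i]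
    · refine ⟨a, b - η * (b - a), by linarith, hpersist _ _ _ fun i => ⟨(hkN i).1, ?_⟩⟩
      have := mul_le_mul_of_nonneg_left hc hε.le
      linarith [hhi i, hηG i]

end PositiveProducts

/-- Geometric decay in the number of blocks of length `N` is geometric decay. -/
theorem exists_geometric_of_block {ρ : ℝ} (hρ : 0 < ρ) (hρ1 : ρ < 1) {N : ℕ} (hN : 0 < N) :
    ∃ C q : ℝ, 0 < C ∧ 0 < q ∧ q < 1 ∧ ∀ t : ℕ, ρ ^ (t / N) ≤ C * q ^ t := by
  set q : ℝ := ρ ^ ((N : ℝ)⁻¹) with hq_def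
  have hq : 0 < q := Real.rpow_pos_of_pos hρ _
  have hq1 : q < 1 := Real.rpow_lt_one hρ.le hρ1 (by positivity)
  have hqN : q ^ N = ρ := Real.rpow_inv_natCast_pow hρ.le hN.ne'
  refine ⟨(q ^ N)⁻¹, q, by positivity, hq, hq1, fun t => ?_⟩
  rw [le_inv_mul_iff₀ (by positivity)]
  calc q ^ N * ρ ^ (t / N) = q ^ (N + N * (t / N)) := by rw [pow_add, pow_mul, hqN]
    _ ≤ q ^ t := pow_le_pow_of_le_one hq.le hq1.le (by
        have := Nat.div_add_mod t N
        have := Nat.mod_lt t hN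
        omega)

section EuclNorm

variable {d : ℕ}

theorem euclNorm_eq (x : Fin d → ℝ) : euclNorm x = ‖WithLp.toLp 2 x‖ := by
  simp [euclNorm, EuclideanSpace.norm_eq]

theorem euclNorm_pos {x : Fin d → ℝ} (hx : x ≠ 0) : 0 < euclNorm x := by
  rw [euclNorm_eq, norm_pos_iff]
  simpa using hx

theorem euclNorm_smul (r : ℝ) (x : Fin d → ℝ) : euclNorm (r • x) = |r| * euclNorm x := by
  rw [euclNorm_eq, euclNorm_eq, WithLp.toLp_smul, norm_smul, Real.norm_eq_abs]

theorem euclNorm_sum_le {ι : Type*} (s : Finset ι) (f : ι → Fin d → ℝ) :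
    euclNorm (∑ i ∈ s, f i) ≤ ∑ i ∈ s, euclNorm (f i) := by
  simp only [euclNorm_eq, WithLp.toLp_sum]
  exact norm_sum_le _ _

theorem euclNorm_sub_le_add (x y : Fin d → ℝ) : euclNorm x - euclNorm y ≤ euclNorm (x + y) := by
  simp only [euclNorm_eq, WithLp.toLp_add]
  exact norm_sub_le_norm_add _ _

theorem abs_le_euclNorm (x : Fin d → ℝ) (c : Fin d) : |x c| ≤ euclNorm x := by
  rw [euclNorm_eq]
  exact PiLp.norm_apply_le (WithLp.toLp 2 x) c

theorem euclNorm_le_sum_abs (x : Fin d → ℝ) : euclNorm x ≤ ∑ c, |x c| := by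
  refine Real.sqrt_le_iff.mpr ⟨Finset.sum_nonneg fun _ _ => abs_nonneg _, ?_⟩
  simpa using Finset.sum_sq_le_sq_sum_of_nonneg (s := Finset.univ) (f := fun c => |x c|)
    fun _ _ => abs_nonneg _

theorem normalize_smul_of_pos {r : ℝ} (hr : 0 < r) (x : Fin d → ℝ) :
    (euclNorm (r • x))⁻¹ • (r • x) = (euclNorm x)⁻¹ • x := by
  rw [euclNorm_smul, abs_of_pos hr, smul_smul, mul_inv]
  congr 1
  field_simp

theorem normalize_mem_unitSphere {x : Fin d → ℝ} (hx : 0 < euclNorm x) :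
    (euclNorm x)⁻¹ • x ∈ unitSphere d := by
  change euclNorm _ = 1
  rw [euclNorm_smul, abs_of_pos (inv_pos.mpr hx), inv_mul_cancel₀ hx.ne']

theorem euclNorm_normalize_sub_le (x : Fin d → ℝ) {y : Fin d → ℝ} (hy : 0 < euclNorm y) :
    euclNorm ((euclNorm x)⁻¹ • x - (euclNorm y)⁻¹ • y) ≤ 2 / euclNorm y * euclNorm (x - y) := by
  simp only [euclNorm_eq, WithLp.toLp_sub, WithLp.toLp_smul] at hy ⊢
  generalize WithLp.toLp 2 x = x at *
  generalize WithLp.toLp 2 y = y at *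
  have hdecomp : ‖x‖⁻¹ • x - ‖y‖⁻¹ • y =
      ‖y‖⁻¹ • ((‖y‖ - ‖x‖) • (‖x‖⁻¹ • x) + (x - y)) := by
    rcases eq_or_ne x 0 with rfl | hx
    · simp
    · have hx' : ‖x‖ ≠ 0 := norm_ne_zero_iff.mpr hx
      rw [sub_smul, smul_smul ‖x‖, mul_inv_cancel₀ hx', one_smul, sub_add_sub_cancel, smul_sub,
        smul_smul, inv_mul_cancel₀ hy.ne', one_smul]
  have hunit : ‖‖x‖⁻¹ • x‖ ≤ 1 := by
    rw [norm_smul, norm_inv, norm_norm]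
    exact inv_mul_le_one
  have hdiff : |‖y‖ - ‖x‖| ≤ ‖x - y‖ := by
    rw [abs_sub_comm]
    exact abs_norm_sub_norm_le x y
  calc ‖‖x‖⁻¹ • x - ‖y‖⁻¹ • y‖
      = ‖y‖⁻¹ * ‖(‖y‖ - ‖x‖) • (‖x‖⁻¹ • x) + (x - y)‖ := by
        rw [hdecomp, norm_smul, norm_inv, norm_norm]
    _ ≤ ‖y‖⁻¹ * (‖x - y‖ * 1 + ‖x - y‖) := by
        refine mul_le_mul_of_nonneg_left ((norm_add_le _ _).trans ?_) (by positivity)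
        rw [norm_smul, Real.norm_eq_abs]
        gcongr
    _ = 2 / ‖y‖ * ‖x - y‖ := by ring

end EuclNorm

section Dynamics

variable {n d : ℕ} {A : Matrix (Fin n) (Fin n) ℝ} {γbar : Fin n → (Fin d → ℝ) → ℝ}
  {X₀ : Matrix (Fin n) (Fin d) ℝ}

theorem IsDirectional.sInf_le_le_sSup {γ : (Fin d → ℝ) → ℝ} (hγ : IsDirectional γ)
    {x : Fin d → ℝ} (hx : x ∈ unitSphere d) :
    sInf (γ '' unitSphere d) ≤ γ x ∧ γ x ≤ sSup (γ '' unitSphere d) := by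
  obtain ⟨_, c, C, _, hb⟩ := hγ
  refine ⟨csInf_le ⟨c, ?_⟩ ⟨x, hx, rfl⟩, le_csSup ⟨C, ?_⟩ ⟨x, hx, rfl⟩⟩
  · rintro _ ⟨y, hy, rfl⟩; exact (hb y hy).1
  · rintro _ ⟨y, hy, rfl⟩; exact (hb y hy).2

theorem IsDirectional.sInf_pos {γ : (Fin d → ℝ) → ℝ} (hγ : IsDirectional γ)
    (hne : (unitSphere d).Nonempty) : 0 < sInf (γ '' unitSphere d) := by
  obtain ⟨_, c, C, hc, hb⟩ := hγ
  refine hc.trans_le (le_csInf (hne.image γ) ?_)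
  rintro _ ⟨y, hy, rfl⟩
  exact (hb y hy).1

theorem IsDirectional.euclNorm_bounds {γ : (Fin d → ℝ) → ℝ} (hγ : IsDirectional γ)
    {y : Fin d → ℝ} (hy : y ∈ starBoundary γ) :
    sInf (γ '' unitSphere d) ≤ euclNorm y ∧ euclNorm y ≤ sSup (γ '' unitSphere d) := by
  obtain ⟨x, hx, rfl⟩ := hy
  have hpos : 0 < γ x := (hγ.sInf_pos ⟨x, hx⟩).trans_le (hγ.sInf_le_le_sSup hx).1
  have hx1 : euclNorm x = 1 := hx
  rw [euclNorm_smul, hx1, mul_one, abs_of_pos hpos]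
  exact hγ.sInf_le_le_sSup hx

theorem Assumption2.nonneg (hA : Assumption2 A γbar) (i j : Fin n) : 0 ≤ A i j := by
  obtain ⟨_, ⟨E, hE, hE0, _⟩, _⟩ := hA
  by_cases h : E i j
  · exact (hE i j h).le
  · exact (hE0 i j h).ge

theorem row_mul_eq_sum (X : Matrix (Fin n) (Fin d) ℝ) (i : Fin n) :
    (A * X) i = ∑ j, A i j • X j := by
  ext c
  simp [Matrix.mul_apply]

/-- Diagonal dominance keeps the rows of `A X` away from zero. -/
theorem Assumption2.euclNorm_row_bounds (hA : Assumption2 A γbar)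
    {X : Matrix (Fin n) (Fin d) ℝ} (hX : X ∈ Sset n d γbar) (i : Fin n) :
    A i i * sInf (γbar i '' unitSphere d) -
        ∑ j ∈ Finset.univ.erase i, A i j * sSup (γbar j '' unitSphere d) ≤
      euclNorm ((A * X) i) ∧
    euclNorm ((A * X) i) ≤ ∑ j, A i j * sSup (γbar j '' unitSphere d) := by
  have hterm : ∀ j, euclNorm (A i j • X j) ≤ A i j * sSup (γbar j '' unitSphere d) := by
    intro j
    rw [euclNorm_smul, abs_of_nonneg (hA.nonneg i j)]
    exact mul_le_mul_of_nonneg_left ((hA.1 j).euclNorm_bounds (hX j)).2 (hA.nonneg i j)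
  rw [row_mul_eq_sum]
  refine ⟨?_, (euclNorm_sum_le _ _).trans (Finset.sum_le_sum fun j _ => hterm j)⟩
  rw [← Finset.add_sum_erase _ _ (Finset.mem_univ i)]
  refine le_trans (sub_le_sub ?_ ?_) (euclNorm_sub_le_add _ _)
  · rw [euclNorm_smul, abs_of_nonneg (hA.nonneg i i)]
    exact mul_le_mul_of_nonneg_left ((hA.1 i).euclNorm_bounds (hX i)).1 (hA.nonneg i i)
  · exact (euclNorm_sum_le _ _).trans (Finset.sum_le_sum fun j _ => hterm j)

theorem Assumption2.euclNorm_row_pos (hA : Assumption2 A γbar)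
    {X : Matrix (Fin n) (Fin d) ℝ} (hX : X ∈ Sset n d γbar) (i : Fin n) :
    0 < euclNorm ((A * X) i) :=
  (sub_pos.mpr (hA.2.2 i)).trans_le (hA.euclNorm_row_bounds hX i).1

theorem Assumption2.traj_mem (hA : Assumption2 A γbar) (hX₀ : X₀ ∈ Sset n d γbar) (t : ℕ) :
    traj A γbar X₀ t ∈ Sset n d γbar := by
  induction t with
  | zero => exact hX₀
  | succ t ih =>
    exact fun i => ⟨_, normalize_mem_unitSphere (hA.euclNorm_row_pos ih i), rfl⟩

theorem Assumption2.diag_pos (hA : Assumption2 A γbar) (hne : (unitSphere d).Nonempty)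
    (i : Fin n) : 0 < A i i := by
  have hsum : 0 ≤ ∑ j ∈ Finset.univ.erase i, A i j * sSup (γbar j '' unitSphere d) :=
    Finset.sum_nonneg fun j _ => mul_nonneg (hA.nonneg i j) <| by
      obtain ⟨x, hx⟩ := hne
      exact ((hA.1 j).sInf_pos ⟨x, hx⟩).le.trans
        (((hA.1 j).sInf_le_le_sSup hx).1.trans ((hA.1 j).sInf_le_le_sSup hx).2)
  exact pos_of_mul_pos_left (hsum.trans_lt (hA.2.2 i)) ((hA.1 i).sInf_pos hne).le

theorem rowProj_eq (B : Matrix (Fin n) (Fin d) ℝ) : rowProj γbar B = Dmat γbar B * B := by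
  ext i c
  simp only [rowProj, radialProj, Dmat, Matrix.of_apply, Matrix.diagonal_mul, Pi.smul_apply,
    smul_eq_mul, div_eq_mul_inv, mul_assoc]

theorem traj_succ (t : ℕ) : traj A γbar X₀ (t + 1) =
    (Dmat γbar (A * traj A γbar X₀ t) * A) * traj A γbar X₀ t := by
  rw [Matrix.mul_assoc, ← rowProj_eq]
  rfl

theorem traj_eq_Atilde_mul (t : ℕ) : traj A γbar X₀ t = Atilde A γbar X₀ t * X₀ := by
  induction t with
  | zero => simp [traj, Atilde]
  | succ t ih =>
    rw [traj_succ, Atilde, Matrix.mul_assoc _ (Atilde A γbar X₀ t), ← ih]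

/-- The step matrices of the algorithm are uniformly comparable to `A`. -/
theorem Assumption2.exists_comparable (hA : Assumption2 A γbar) (hX₀ : X₀ ∈ Sset n d γbar)
    (hne : (unitSphere d).Nonempty) :
    ∃ δ Δ : ℝ, Comparable A (fun t => Dmat γbar (A * traj A γbar X₀ t) * A) δ Δ := by
  have hinf := fun i => (hA.1 i).sInf_pos hne
  have hnorm := fun t i => hA.euclNorm_row_bounds (hA.traj_mem hX₀ t) i
  have hnpos := fun t i => hA.euclNorm_row_pos (hA.traj_mem hX₀ t) i
  have hup : ∀ i, 0 < ∑ j, A i j * sSup (γbar j '' unitSphere d) :=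
    fun i => (hnpos 0 i).trans_le (hnorm 0 i).2
  obtain ⟨δ, hδ, hδle⟩ := exists_pos_forall_le (f := fun i =>
    sInf (γbar i '' unitSphere d) / ∑ j, A i j * sSup (γbar j '' unitSphere d))
    fun i => div_pos (hinf i) (hup i)
  obtain ⟨Δ, hΔ, hleΔ⟩ := exists_pos_forall_ge fun i =>
    sSup (γbar i '' unitSphere d) / (A i i * sInf (γbar i '' unitSphere d) -
        ∑ j ∈ Finset.univ.erase i, A i j * sSup (γbar j '' unitSphere d))
  refine ⟨δ, Δ, hA.nonneg, hδ, hΔ, fun t i j => ?_, fun t i j => ?_⟩ <;>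
    rw [Dmat, Matrix.diagonal_mul] <;>
    refine mul_le_mul_of_nonneg_right ?_ (hA.nonneg i j) <;>
    have hγ := (hA.1 i).sInf_le_le_sSup (normalize_mem_unitSphere (hnpos t i))
  · exact (hδle i).trans
      (div_le_div₀ ((hinf i).le.trans hγ.1) hγ.1 (hnpos t i) (hnorm t i).2)
  · exact (div_le_div₀ ((hinf i).le.trans (hγ.1.trans hγ.2)) hγ.2
      (sub_pos.mpr (hA.2.2 i)) (hnorm t i).1).trans (hleΔ i)

theorem IsLimitVec.tendsto_ratio {v : Fin n → ℝ} (hv : IsLimitVec A γbar X₀ v) (i : Fin n)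
    (hpos : ∀ t, 0 < (Atilde A γbar X₀ t *ᵥ fun _ => 1) i) (c : Fin d) :
    Tendsto (fun t => traj A γbar X₀ t i c / (Atilde A γbar X₀ t *ᵥ fun _ => 1) i) atTop
      (𝓝 ((∑ j, v j)⁻¹ * Matrix.vecMul v X₀ c)) := by
  have hsum : 0 < ∑ j, v j := Finset.sum_pos (fun j _ => hv.2.1 j) ⟨i, Finset.mem_univ i⟩
  have hcoord := fun j => tendsto_pi_nhds.mp (hv.2.2 i) j
  have hnum : Tendsto (fun t => ∑ j, ((euclNorm (Atilde A γbar X₀ t i))⁻¹ •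
      Atilde A γbar X₀ t i) j * X₀ j c) atTop (𝓝 (∑ j, v j * X₀ j c)) :=
    tendsto_finsetSum _ fun j _ => (hcoord j).mul_const _
  have hden := tendsto_finsetSum Finset.univ fun j _ => hcoord j
  have hlim := hnum.div hden hsum.ne'
  have htarget : (∑ j, v j)⁻¹ * Matrix.vecMul v X₀ c = (∑ j, v j * X₀ j c) / ∑ j, v j := by
    rw [div_eq_inv_mul]; rfl
  rw [htarget]
  refine hlim.congr fun t => ?_
  have hne : Atilde A γbar X₀ t i ≠ 0 := by
    intro h0
    have := hpos t
    simp [Matrix.mulVec, h0] at this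
  have hr := (inv_pos.mpr (euclNorm_pos hne)).ne'
  simp only [Pi.div_apply, Pi.smul_apply, smul_eq_mul, mul_assoc, ← Finset.mul_sum]
  rw [mul_div_mul_left _ _ hr, traj_eq_Atilde_mul, Matrix.mul_apply]
  simp [Matrix.mulVec, dotProduct]

/-- The trajectory, rescaled by the row sums of the product matrices, converges geometrically. -/
theorem Assumption2.exists_geometric_bound (hA : Assumption2 A γbar) (hX₀ : X₀ ∈ Sset n d γbar)
    (hne : (unitSphere d).Nonempty) {v : Fin n → ℝ} (hv : IsLimitVec A γbar X₀ v) :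
    (∀ t i, 0 < (Atilde A γbar X₀ t *ᵥ fun _ => 1) i) ∧
    ∃ C q : ℝ, 0 ≤ C ∧ 0 < q ∧ q < 1 ∧ ∀ i t,
      euclNorm (((Atilde A γbar X₀ t *ᵥ fun _ => 1) i)⁻¹ • traj A γbar X₀ t i -
        (∑ j, v j)⁻¹ • Matrix.vecMul v X₀) ≤ C * q ^ t := by
  obtain ⟨δ, Δ, hcomp⟩ := hA.exists_comparable hX₀ hne
  have hdiag := hA.diag_pos hne
  obtain ⟨E, hE, _, hconn⟩ := hA.2.1
  obtain ⟨N, hN, hApos⟩ := exists_pow_entry_pos hA.nonneg hdiag hE hconn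
  set g : ℕ → Fin n → ℝ := fun t => Atilde A γbar X₀ t *ᵥ fun _ => 1 with hg_def
  have hg : ∀ t, g (t + 1) = (Dmat γbar (A * traj A γbar X₀ t) * A) *ᵥ g t := fun t => by
    simp only [hg_def, Atilde, Matrix.mulVec_mulVec]
  have hg0 : ∀ i, g 0 i = 1 := fun i => by simp [hg_def, Atilde]
  have hgpos : ∀ t i, 0 < g t i := by
    intro t
    induction t with
    | zero => exact fun i => by rw [hg0]; exact one_pos
    | succ t ih =>
      intro i
      rw [hg]
      exact Finset.sum_pos' (fun j _ => mul_nonneg (hcomp.entry_nonneg t i j) (ih j).le)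
        ⟨i, Finset.mem_univ i, mul_pos
          ((mul_pos hcomp.pos (hdiag i)).trans_le (hcomp.lower t i i)) (ih i)⟩
  refine ⟨hgpos, ?_⟩
  obtain ⟨ρ, hρ, hρ1, hratio⟩ := hcomp.exists_nested_ratio_bounds hApos
  have hf : ∀ c t, (fun i => traj A γbar X₀ (t + 1) i c) =
      (Dmat γbar (A * traj A γbar X₀ t) * A) *ᵥ fun i => traj A γbar X₀ t i c := by
    intro c t
    rw [traj_succ]
    rfl
  choose B hB hnest using fun c => hratio (fun t i => traj A γbar X₀ t i c) g (hf c) hg hg0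
  obtain ⟨C, q, hC, hq, hq1, hgeom⟩ := exists_geometric_of_block hρ hρ1 hN
  have hBsum : 0 ≤ ∑ c, B c := Finset.sum_nonneg fun c _ => hB c
  refine ⟨(∑ c, B c) * C, q, mul_nonneg hBsum hC.le, hq, hq1, fun i t => ?_⟩
  calc euclNorm ((g t i)⁻¹ • traj A γbar X₀ t i - (∑ j, v j)⁻¹ • Matrix.vecMul v X₀)
      ≤ ∑ c, |((g t i)⁻¹ • traj A γbar X₀ t i - (∑ j, v j)⁻¹ • Matrix.vecMul v X₀) c| :=
        euclNorm_le_sum_abs _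
    _ ≤ ∑ c, B c * ρ ^ (t / N) := by
        refine Finset.sum_le_sum fun c _ => ?_
        obtain ⟨a, b, hab, hbd⟩ := hnest c (t / N)
        have hmem : ∀ s, t / N * N ≤ s →
            a ≤ traj A γbar X₀ s i c / g s i ∧ traj A γbar X₀ s i c / g s i ≤ b := fun s hs =>
          ⟨(le_div_iff₀ (hgpos s i)).mpr (hbd s hs i).1,
            (div_le_iff₀ (hgpos s i)).mpr (hbd s hs i).2⟩
        have hlim := hv.tendsto_ratio i (fun s => hgpos s i) c
        have hev := eventually_ge_atTop (t / N * N)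
        have ha := ge_of_tendsto hlim (hev.mono fun s hs => (hmem s hs).1)
        have hb := le_of_tendsto hlim (hev.mono fun s hs => (hmem s hs).2)
        have hnow := hmem t (Nat.div_mul_le_self t N)
        rw [div_eq_inv_mul] at hnow
        simp only [Pi.sub_apply, Pi.smul_apply, smul_eq_mul]
        refine le_trans (abs_le.mpr ⟨?_, ?_⟩) hab <;> linarith [hnow.1, hnow.2]
    _ = (∑ c, B c) * ρ ^ (t / N) := by rw [Finset.sum_mul]
    _ ≤ (∑ c, B c) * (C * q ^ t) := mul_le_mul_of_nonneg_left (hgeom t) hBsum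
    _ = (∑ c, B c) * C * q ^ t := by ring

end Dynamics

theorem stmt11 {n d : ℕ} (hn : 1 ≤ n) (hd : 1 ≤ d)
    (A : Matrix (Fin n) (Fin n) ℝ) (γbar : Fin n → (Fin d → ℝ) → ℝ)
    (hA : Assumption2 A γbar)
    (X₀ : Matrix (Fin n) (Fin d) ℝ) (hX₀ : X₀ ∈ Sset n d γbar)
    (v : Fin n → ℝ) (hv : IsLimitVec A γbar X₀ v)
    (hne : Matrix.vecMul v X₀ ≠ (0 : Fin d → ℝ)) :
    (∀ i, Tendsto (fun t => (euclNorm (traj A γbar X₀ t i))⁻¹ • traj A γbar X₀ t i)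
      atTop (𝓝 ((euclNorm (Matrix.vecMul v X₀))⁻¹ • Matrix.vecMul v X₀))) ∧
    ∃ C q : ℝ, 0 < C ∧ 0 < q ∧ q < 1 ∧
      ∀ (i : Fin n) (t : ℕ),
        euclNorm ((euclNorm (traj A γbar X₀ t i))⁻¹ • traj A γbar X₀ t i -
          (euclNorm (Matrix.vecMul v X₀))⁻¹ • Matrix.vecMul v X₀) ≤ C * q ^ t := by
  have i₀ : Fin n := ⟨0, hn⟩
  have hsph : (unitSphere d).Nonempty := let ⟨x, hx, _⟩ := hX₀ i₀; ⟨x, hx⟩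
  obtain ⟨hgpos, C, q, hC, hq, hq1, hbound⟩ := hA.exists_geometric_bound hX₀ hsph hv
  have hsum : 0 < (∑ j, v j)⁻¹ :=
    inv_pos.mpr (Finset.sum_pos (fun j _ => hv.2.1 j) ⟨i₀, Finset.mem_univ i₀⟩)
  set w := Matrix.vecMul v X₀
  have hu : 0 < euclNorm ((∑ j, v j)⁻¹ • w) := euclNorm_pos (smul_ne_zero hsum.ne' hne)
  set K := 2 / euclNorm ((∑ j, v j)⁻¹ • w) * C + 1
  have hK : 0 < K := by positivity
  have hrate : ∀ (i : Fin n) (t : ℕ),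
      euclNorm ((euclNorm (traj A γbar X₀ t i))⁻¹ • traj A γbar X₀ t i -
        (euclNorm w)⁻¹ • w) ≤ K * q ^ t := by
    intro i t
    rw [← normalize_smul_of_pos (inv_pos.mpr (hgpos t i)) (traj A γbar X₀ t i),
      ← normalize_smul_of_pos hsum w]
    refine (euclNorm_normalize_sub_le _ hu).trans ?_
    refine (mul_le_mul_of_nonneg_left (hbound i t) (by positivity)).trans ?_
    rw [← mul_assoc]
    exact mul_le_mul_of_nonneg_right (le_add_of_nonneg_right zero_le_one) (by positivity)
  refine ⟨fun i => tendsto_pi_nhds.mpr fun c => ?_, K, q, hK, hq, hq1, hrate⟩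
  have hgeom : Tendsto (fun t : ℕ => K * q ^ t) atTop (𝓝 0) := by
    simpa using (tendsto_pow_atTop_nhds_zero_of_lt_one hq.le hq1).const_mul K
  rw [tendsto_iff_dist_tendsto_zero]
  exact squeeze_zero (fun _ => dist_nonneg)
    (fun t => (abs_le_euclNorm _ c).trans (hrate i t)) hgeom
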